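/- Assume there exists ε > 0 with E[|F|^{2+ε}] < ∞. Then the functional V : H → ℝ, V(h) = E[F² exp(−G h + ‖h‖_H²/2)], is continuous: for every h ∈ H and every sequence (h_n) in H with ‖h_n − h‖_H → 0 one has V(h_n) → V(h). -/

import Mathlib

open MeasureTheory ProbabilityTheory Filter ENNReal

/-- The importance-sampling second-moment functional
`V(h) = E[F² exp(−G h + ‖h‖²/2)]`, valued in `[0,∞]`. -/
noncomputable def Vfun {Ω : Type*} [MeasurableSpace Ω] (P : Measure Ω)
    {H : Type*} [NormedAddCommGroup H] [InnerProductSpace ℝ H]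
    (F : Ω → ℝ) (G : H →ₗ[ℝ] Lp ℝ 2 P) (h : H) : ℝ≥0∞ :=
  ∫⁻ ω, ENNReal.ofReal ((F ω) ^ 2 * Real.exp (-(G h) ω + ‖h‖ ^ 2 / 2)) ∂P

/-- An exponential of a linear function of `|z|` has finite standard Gaussian expectation. -/
lemma lintegral_exp_mul_abs_add_gaussianReal_lt_top (a b : ℝ) :
    ∫⁻ z, ENNReal.ofReal (Real.exp (a * |z| + b)) ∂(gaussianReal 0 1) < ⊤ := by
  have hint : Integrable (fun z : ℝ => Real.exp (a * |z|)) (gaussianReal 0 1) :=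
    integrable_exp_mul_abs (X := fun z : ℝ => z) (integrable_exp_mul_gaussianReal a)
      (integrable_exp_mul_gaussianReal (-a))
  simp only [Real.exp_add]
  exact (hint.mul_const _).lintegral_lt_top

/-- A Gaussian variable of mean `0` and variance `s²` is distributed as `s` times a standard
Gaussian variable. -/
lemma lintegral_comp_of_map_eq_gaussianReal {Ω : Type*} [MeasurableSpace Ω] {P : Measure Ω}
    {Y : Ω → ℝ} (hY : AEMeasurable Y P) {s : NNReal} (hlaw : P.map Y = gaussianReal 0 (s ^ 2))
    {g : ℝ → ℝ≥0∞} (hg : Measurable g) :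
    ∫⁻ ω, g (Y ω) ∂P = ∫⁻ z, g (s * z) ∂(gaussianReal 0 1) := by
  have hmap : gaussianReal 0 (s ^ 2) = (gaussianReal 0 1).map ((s : ℝ) * ·) := by
    rw [gaussianReal_map_const_mul]
    congr 1
    · simp
    · ext; simp
  rw [← lintegral_map' hg.aemeasurable hY, hlaw, hmap, lintegral_map hg (by fun_prop)]

/-- The moments of `exp (-s z + c) - 1` under the standard Gaussian law vanish as
`s, c → 0`. -/
lemma tendsto_lintegral_abs_exp_sub_one_rpow {s : ℕ → NNReal} {c : ℕ → ℝ}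
    (hs : Tendsto s atTop (nhds 0)) (hc : Tendsto c atTop (nhds 0)) {r : ℝ} (hr : 0 < r) :
    Tendsto (fun n => ∫⁻ z, ENNReal.ofReal |Real.exp (-(s n * z) + c n) - 1| ^ r
      ∂(gaussianReal 0 1)) atTop (nhds 0) := by
  have hs' : Tendsto (fun n => (s n : ℝ)) atTop (nhds 0) := by
    simpa using (NNReal.tendsto_coe.2 hs)
  have key := tendsto_lintegral_filter_of_dominated_convergence (μ := gaussianReal 0 1)
    (l := atTop) (F := fun n z => ENNReal.ofReal |Real.exp (-(s n * z) + c n) - 1| ^ r)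
    (f := fun _ => 0) (fun z => ENNReal.ofReal (Real.exp (r * |z| + r)))
    (Eventually.of_forall fun n => by fun_prop) ?_
    (lintegral_exp_mul_abs_add_gaussianReal_lt_top r r).ne ?_
  · simpa using key
  · filter_upwards [hs'.eventually_lt_const one_pos,
      hc.abs.eventually_lt_const (show |(0 : ℝ)| < 1 by simp)] with n h1 h2
    refine Eventually.of_forall fun z => ?_
    rw [ENNReal.ofReal_rpow_of_nonneg (abs_nonneg _) hr.le]
    refine ENNReal.ofReal_le_ofReal ?_
    have hx : |-(s n * z) + c n| ≤ |z| + 1 := by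
      refine (abs_add_le _ _).trans (add_le_add ?_ h2.le)
      rw [abs_neg, abs_mul, abs_of_nonneg (s n).coe_nonneg]
      exact mul_le_of_le_one_left (abs_nonneg _) h1.le
    have hy : |Real.exp (-(s n * z) + c n) - 1| ≤ Real.exp (|z| + 1) := by
      set x := -(s n * z) + c n
      rw [abs_le]
      have h3 : Real.exp x ≤ Real.exp (|z| + 1) :=
        Real.exp_le_exp.2 ((le_abs_self x).trans hx)
      have h4 : 1 ≤ Real.exp (|z| + 1) := Real.one_le_exp (by positivity)
      constructor <;> linarith [Real.exp_pos x]
    calc |Real.exp (-(s n * z) + c n) - 1| ^ r ≤ Real.exp (|z| + 1) ^ r :=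
          Real.rpow_le_rpow (abs_nonneg _) hy hr.le
      _ = Real.exp (r * |z| + r) := by rw [← Real.exp_mul]; ring_nf
  · refine Eventually.of_forall fun z => ?_
    have h1 : Tendsto (fun n => |Real.exp (-(s n * z) + c n) - 1|) atTop (nhds 0) := by
      have h2 := (((hs'.mul_const z).neg.add hc).rexp.sub_const 1).abs
      simpa using h2
    have h3 := (ENNReal.tendsto_ofReal h1).ennrpow_const r
    simpa [ENNReal.zero_rpow_of_pos hr] using h3

/-- Under the moment condition `E[|F|^{2+ε}] < ∞`, the functional `V` is (sequentially)
continuous on `H`. -/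
theorem stmt_13 {Ω : Type*} [MeasurableSpace Ω] (P : Measure Ω) [IsProbabilityMeasure P]
    {H : Type*} [NormedAddCommGroup H] [InnerProductSpace ℝ H] [CompleteSpace H]
    [TopologicalSpace.SeparableSpace H]
    (F : Ω → ℝ) (hF : Measurable F)
    (G : H →ₗ[ℝ] Lp ℝ 2 P)
    (hG : ∀ h : H, P.map (G h) = gaussianReal 0 (‖h‖₊ ^ 2))
    (ε : ℝ) (hε : 0 < ε)
    (hmom : ∫⁻ ω, ENNReal.ofReal (|F ω| ^ (2 + ε)) ∂P < ⊤) :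
    ∀ (h : H) (hn : ℕ → H), Tendsto hn atTop (nhds h) →
      Tendsto (fun n => Vfun P F G (hn n)) atTop (nhds (Vfun P F G h)) := by
  intro h hn hlim
  have hGm : ∀ k : H, AEMeasurable (G k) P := fun k => (Lp.aestronglyMeasurable (G k)).aemeasurable
  set p : ℝ := (2 + ε) / 2 with hp
  have hpq : p.HolderConjugate p.conjExponent :=
    Real.HolderConjugate.conjExponent (by rw [hp]; linarith)
  set q : ℝ := p.conjExponent
  have hq : 0 < q := hpq.symm.pos
  let c : ℕ → ℝ := fun n => (‖hn n‖ ^ 2 - ‖h‖ ^ 2) / 2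
  have hc : Tendsto c atTop (nhds 0) := by
    have := (((hlim.norm.pow 2).sub_const (‖h‖ ^ 2)).div_const 2)
    simpa using this
  have hd : Tendsto (fun n => ‖hn n - h‖₊) atTop (nhds 0) := by
    have := (hlim.sub_const h).nnnorm
    simpa using this
  let A : Ω → ℝ≥0∞ := fun ω => ENNReal.ofReal (F ω ^ 2)
  let X : Ω → ℝ≥0∞ := fun ω => ENNReal.ofReal (Real.exp (-(G h) ω + ‖h‖ ^ 2 / 2))
  let W : ℕ → Ω → ℝ≥0∞ := fun n ω =>
    ENNReal.ofReal |Real.exp (-(G (hn n - h)) ω + c n) - 1|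
  have hA : AEMeasurable A P := by fun_prop
  have hX : AEMeasurable X P := by have := hGm h; fun_prop
  have hW : ∀ n, AEMeasurable (W n) P := fun n => by
    have := hGm (hn n - h)
    exact ((((this.neg.add_const (c n)).exp).sub_const 1).abs).ennreal_ofReal
  let δ : ℕ → ℝ≥0∞ := fun n => ∫⁻ ω, A ω * (X ω * W n ω) ∂P
  have hAX : AEMeasurable (fun ω => A ω * X ω) P := hA.mul hX
  have hAXW : ∀ n, AEMeasurable (fun ω => A ω * (X ω * W n ω)) P := fun n =>
    hA.mul (hX.mul (hW n))
  have hVh : Vfun P F G h = ∫⁻ ω, A ω * X ω ∂P := by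
    refine lintegral_congr fun ω => ?_
    exact ENNReal.ofReal_mul (sq_nonneg _)
  have hVn : ∀ n, Vfun P F G (hn n) = ∫⁻ ω, A ω *
      (X ω * ENNReal.ofReal (Real.exp (-(G (hn n - h)) ω + c n))) ∂P := fun n => by
    refine lintegral_congr_ae ?_
    have hsub : (G (hn n - h) : Ω → ℝ) =ᵐ[P] G (hn n) - G h := by
      rw [map_sub]; exact Lp.coeFn_sub _ _
    filter_upwards [hsub] with ω hω
    rw [ENNReal.ofReal_mul (sq_nonneg _), ← ENNReal.ofReal_mul (Real.exp_pos _).le,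
      ← Real.exp_add, hω, Pi.sub_apply]
    simp only [A, c]
    ring_nf
  have hupper : ∀ n, Vfun P F G (hn n) ≤ Vfun P F G h + δ n := fun n => by
    rw [hVn, hVh, ← lintegral_add_left' hAX]
    refine lintegral_mono fun ω => ?_
    simp only [W]
    rw [← mul_add]
    gcongr
    nth_rewrite 2 [← mul_one (X ω)]
    rw [← mul_add, ← ENNReal.ofReal_one, ← ENNReal.ofReal_add zero_le_one (abs_nonneg _)]
    gcongr
    linarith [le_abs_self (Real.exp (-(G (hn n - h)) ω + c n) - 1)]
  have hlower : ∀ n, Vfun P F G h ≤ Vfun P F G (hn n) + δ n := fun n => by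
    rw [hVn, hVh, ← lintegral_add_right' _ (hAXW n)]
    refine lintegral_mono fun ω => ?_
    simp only [W]
    rw [← mul_add]
    gcongr
    nth_rewrite 1 [← mul_one (X ω)]
    rw [← mul_add, ← ENNReal.ofReal_one,
      ← ENNReal.ofReal_add (Real.exp_pos _).le (abs_nonneg _)]
    gcongr
    linarith [neg_abs_le (Real.exp (-(G (hn n - h)) ω + c n) - 1)]
  have hAp : ∫⁻ ω, A ω ^ p ∂P < ⊤ := by
    refine lt_of_eq_of_lt (lintegral_congr fun ω => ?_) hmom
    rw [ENNReal.ofReal_rpow_of_nonneg (sq_nonneg _) hpq.nonneg, ← sq_abs, ← Real.rpow_natCast,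
      ← Real.rpow_mul (abs_nonneg _)]
    congr 2
    rw [hp]; push_cast; ring
  have hXq : ∫⁻ ω, (X ω ^ q) ^ (2 : ℝ) ∂P < ⊤ := by
    have hlaw := lintegral_comp_of_map_eq_gaussianReal (hGm h) (hG h)
      (g := fun y => (ENNReal.ofReal (Real.exp (-y + ‖h‖ ^ 2 / 2)) ^ q) ^ (2 : ℝ)) (by fun_prop)
    refine lt_of_eq_of_lt hlaw (lt_of_le_of_lt (lintegral_mono fun z => ?_)
      (lintegral_exp_mul_abs_add_gaussianReal_lt_top (‖h‖ * (q * 2)) (‖h‖ ^ 2 / 2 * (q * 2))))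
    simp only
    rw [← ENNReal.rpow_mul, ENNReal.ofReal_rpow_of_nonneg (Real.exp_pos _).le (by positivity),
      ← Real.exp_mul]
    refine ENNReal.ofReal_le_ofReal (Real.exp_le_exp.2 ?_)
    have : -(‖h‖ * z) ≤ ‖h‖ * |z| := by
      rw [← mul_neg]; exact mul_le_mul_of_nonneg_left (neg_le_abs z) (norm_nonneg _)
    calc (-(‖h‖ * z) + ‖h‖ ^ 2 / 2) * (q * 2)
        ≤ (‖h‖ * |z| + ‖h‖ ^ 2 / 2) * (q * 2) := by gcongr
      _ = _ := by ring
  have hWq : Tendsto (fun n => ∫⁻ ω, (W n ω ^ q) ^ (2 : ℝ) ∂P) atTop (nhds 0) := by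
    have := tendsto_lintegral_abs_exp_sub_one_rpow hd hc (r := q * 2) (by positivity)
    refine this.congr fun n => ?_
    simp only [W, ← ENNReal.rpow_mul]
    exact (lintegral_comp_of_map_eq_gaussianReal (hGm (hn n - h)) (hG (hn n - h))
      (g := fun y => ENNReal.ofReal |Real.exp (-y + c n) - 1| ^ (q * 2)) (by fun_prop)).symm
  have hδle : ∀ n, δ n ≤ (∫⁻ ω, A ω ^ p ∂P) ^ (1 / p) *
      ((∫⁻ ω, (X ω ^ q) ^ (2 : ℝ) ∂P) ^ (1 / (2 : ℝ)) *
        (∫⁻ ω, (W n ω ^ q) ^ (2 : ℝ) ∂P) ^ (1 / (2 : ℝ))) ^ (1 / q) := fun n => by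
    refine (ENNReal.lintegral_mul_le_Lp_mul_Lq P hpq hA (hX.mul (hW n))).trans ?_
    gcongr
    simp only [Pi.mul_apply, ENNReal.mul_rpow_of_nonneg _ _ hq.le]
    exact ENNReal.lintegral_mul_le_Lp_mul_Lq P Real.HolderConjugate.two_two
      (hX.pow_const q) ((hW n).pow_const q)
  have hδ : Tendsto δ atTop (nhds 0) := by
    refine tendsto_of_tendsto_of_tendsto_of_le_of_le tendsto_const_nhds ?_
      (fun _ => zero_le) hδle
    have h1 := hWq.ennrpow_const (1 / (2 : ℝ))
    have h2 := (ENNReal.Tendsto.const_mul (a := (∫⁻ ω, (X ω ^ q) ^ (2 : ℝ) ∂P) ^ (1 / (2 : ℝ)))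
      h1 (Or.inr (ENNReal.rpow_ne_top_of_nonneg (by norm_num) hXq.ne))).ennrpow_const (1 / q)
    have h3 := ENNReal.Tendsto.const_mul (a := (∫⁻ ω, A ω ^ p ∂P) ^ (1 / p)) h2
      (Or.inr (ENNReal.rpow_ne_top_of_nonneg (by have := hpq.pos; positivity) hAp.ne))
    have hq' : 0 < 1 / q := by positivity
    rwa [ENNReal.zero_rpow_of_pos (by norm_num), mul_zero, ENNReal.zero_rpow_of_pos hq',
      mul_zero] at h3
  refine tendsto_of_tendsto_of_tendsto_of_le_of_le (g := fun n => Vfun P F G h - δ n)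
    (h := fun n => Vfun P F G h + δ n) ?_ ?_
    (fun n => tsub_le_iff_right.2 (hlower n)) hupper
  · simpa using ENNReal.Tendsto.sub (tendsto_const_nhds (x := Vfun P F G h)) hδ
      (Or.inr ENNReal.zero_ne_top)
  · simpa using (tendsto_const_nhds (x := Vfun P F G h)).add hδ
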